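/- For every LTL formula Φ in the syntactic class TL_GF, there exists a deterministic ω-automaton A over the alphabet 2^V with a Büchi acceptance condition (given by a set F of states, a run is accepting iff it visits F infinitely often) such that A has at most 2^(2^|Φ|) states and A accepts exactly the set of infinite words w with w ⊨ Φ. -/

import Mathlib

/-- LTL formulas over atomic propositions `V`: the constant `true`, variables,
negation, disjunction, next (`X`), and strong until (`SU`). -/
inductive LTL (V : Type) : Type
  | tt : LTL V
  | var : V → LTL V
  | lnot : LTL V → LTL V
  | lor : LTL V → LTL V → LTL V
  | lnext : LTL V → LTL V
  | lsu : LTL V → LTL V → LTL V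

namespace LTL

variable {V : Type}

/-- Semantics: `Sat w φ i` means `w, i ⊨ φ` for an infinite word `w : ℕ → Set V`.
In particular `w, i ⊨ ψ SU φ` iff there is `k ≥ i` with `w, k ⊨ ψ` and
`w, j ⊨ φ` for all `i ≤ j < k`. -/
def Sat (w : ℕ → Set V) : LTL V → ℕ → Prop
  | tt, _ => True
  | var v, i => v ∈ w i
  | lnot φ, i => ¬ Sat w φ i
  | lor φ ψ, i => Sat w φ i ∨ Sat w ψ i
  | lnext φ, i => Sat w φ (i + 1)
  | lsu ψ φ, i => ∃ k, i ≤ k ∧ Sat w ψ k ∧ ∀ j, i ≤ j → j < k → Sat w φ j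

/-- Conjunction, as the abbreviation `¬(¬φ ∨ ¬ψ)`. -/
def land (φ ψ : LTL V) : LTL V := lnot (lor (lnot φ) (lnot ψ))

/-- `F φ := φ SU true`. -/
def lF (φ : LTL V) : LTL V := lsu φ tt

/-- `G φ := ¬ F ¬ φ`. -/
def lG (φ : LTL V) : LTL V := lnot (lF (lnot φ))

/-- Weak until: `ψ U φ := (ψ SU φ) ∨ G φ`. -/
def lwu (ψ φ : LTL V) : LTL V := lor (lsu ψ φ) (lG φ)

/-- Number of nodes of the syntax tree. -/
def size : LTL V → ℕ
  | tt => 1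
  | var _ => 1
  | lnot φ => size φ + 1
  | lor φ ψ => size φ + size ψ + 1
  | lnext φ => size φ + 1
  | lsu ψ φ => size ψ + size φ + 1

mutual
  /-- The syntactic class `TL_G`. -/
  inductive TLG : LTL V → Prop
    | var (v : V) : TLG (LTL.var v)
    | not {φ : LTL V} : TLF φ → TLG (LTL.lnot φ)
    | and {φ ψ : LTL V} : TLG φ → TLG ψ → TLG (LTL.land φ ψ)
    | or {φ ψ : LTL V} : TLG φ → TLG ψ → TLG (LTL.lor φ ψ)
    | next {φ : LTL V} : TLG φ → TLG (LTL.lnext φ)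
    | alw {φ : LTL V} : TLG φ → TLG (LTL.lG φ)
    | wu {ψ φ : LTL V} : TLG ψ → TLG φ → TLG (LTL.lwu ψ φ)
  /-- The syntactic class `TL_F`. -/
  inductive TLF : LTL V → Prop
    | var (v : V) : TLF (LTL.var v)
    | not {φ : LTL V} : TLG φ → TLF (LTL.lnot φ)
    | and {φ ψ : LTL V} : TLF φ → TLF ψ → TLF (LTL.land φ ψ)
    | or {φ ψ : LTL V} : TLF φ → TLF ψ → TLF (LTL.lor φ ψ)
    | next {φ : LTL V} : TLF φ → TLF (LTL.lnext φ)
    | ev {φ : LTL V} : TLF φ → TLF (LTL.lF φ)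
    | su {ψ φ : LTL V} : TLF ψ → TLF φ → TLF (LTL.lsu ψ φ)
end

end LTL

/-- The unique run of a deterministic automaton with transition function `δ`
and initial state `s0` on the infinite word `w`. -/
def detRun {S A : Type} (δ : S → A → S) (s0 : S) (w : ℕ → A) : ℕ → S
  | 0 => s0
  | t + 1 => δ (detRun δ s0 w t) (w t)

namespace LTL

variable {V : Type}

/-- The syntactic class `TL_Prefix`: the closure of `TL_G ∪ TL_F` under `¬, ∧, ∨`. -/
inductive TLPrefix : LTL V → Prop
  | g {φ : LTL V} : TLG φ → TLPrefix φ
  | f {φ : LTL V} : TLF φ → TLPrefix φ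
  | not {φ : LTL V} : TLPrefix φ → TLPrefix (LTL.lnot φ)
  | and {φ ψ : LTL V} : TLPrefix φ → TLPrefix ψ → TLPrefix (LTL.land φ ψ)
  | or {φ ψ : LTL V} : TLPrefix φ → TLPrefix ψ → TLPrefix (LTL.lor φ ψ)

end LTL

namespace LTL

variable {V : Type}

mutual
  /-- The syntactic class `TL_GF`. -/
  inductive TLGF : LTL V → Prop
    | pre {φ : LTL V} : TLPrefix φ → TLGF φ
    | not {φ : LTL V} : TLFG φ → TLGF (LTL.lnot φ)
    | and {φ ψ : LTL V} : TLGF φ → TLGF ψ → TLGF (LTL.land φ ψ)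
    | or {φ ψ : LTL V} : TLGF φ → TLGF ψ → TLGF (LTL.lor φ ψ)
    | next {φ : LTL V} : TLGF φ → TLGF (LTL.lnext φ)
    | alw {φ : LTL V} : TLGF φ → TLGF (LTL.lG φ)
    | wu {ψ φ : LTL V} : TLGF ψ → TLGF φ → TLGF (LTL.lwu ψ φ)
    | suF {ψ φ : LTL V} : TLF ψ → TLGF φ → TLGF (LTL.lsu ψ φ)
  /-- The syntactic class `TL_FG`. -/
  inductive TLFG : LTL V → Prop
    | pre {φ : LTL V} : TLPrefix φ → TLFG φ
    | not {φ : LTL V} : TLGF φ → TLFG (LTL.lnot φ)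
    | and {φ ψ : LTL V} : TLFG φ → TLFG ψ → TLFG (LTL.land φ ψ)
    | or {φ ψ : LTL V} : TLFG φ → TLFG ψ → TLFG (LTL.lor φ ψ)
    | next {φ : LTL V} : TLFG φ → TLFG (LTL.lnext φ)
    | ev {φ : LTL V} : TLFG φ → TLFG (LTL.lF φ)
    | su {ψ φ : LTL V} : TLFG ψ → TLFG φ → TLFG (LTL.lsu ψ φ)
    | wuG {ψ φ : LTL V} : TLFG ψ → TLG φ → TLFG (LTL.lwu ψ φ)
end

/-- The syntactic class `TL_Streett`: the closure of `TL_GF ∪ TL_FG` under `¬, ∧, ∨`. -/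
inductive TLStreett : LTL V → Prop
  | gf {φ : LTL V} : TLGF φ → TLStreett φ
  | fg {φ : LTL V} : TLFG φ → TLStreett φ
  | not {φ : LTL V} : TLStreett φ → TLStreett (LTL.lnot φ)
  | and {φ ψ : LTL V} : TLStreett φ → TLStreett ψ → TLStreett (LTL.land φ ψ)
  | or {φ ψ : LTL V} : TLStreett φ → TLStreett ψ → TLStreett (LTL.lor φ ψ)

end LTL

/-- Formulas in negation normal form over an alphabet `A`. The formula `unt true ψ φ` is the
strong until `ψ SU φ`, and `unt false ψ φ` is the weak until `ψ U φ`. -/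
inductive NNF (A : Type) : Type
  | lit : (A → Prop) → NNF A
  | and : NNF A → NNF A → NNF A
  | or : NNF A → NNF A → NNF A
  | next : NNF A → NNF A
  | unt : Bool → NNF A → NNF A → NNF A

/-- Strong (`s = true`) or weak (`s = false`) until of two time-dependent predicates. -/
def UntilAt (s : Bool) (P Q : ℕ → Prop) (i : ℕ) : Prop :=
  (∃ k, i ≤ k ∧ P k ∧ ∀ j, i ≤ j → j < k → Q j) ∨ (s = false ∧ ∀ j, i ≤ j → Q j)

theorem untilAt_iff {s : Bool} {P Q : ℕ → Prop} {i : ℕ} :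
    UntilAt s P Q i ↔ P i ∨ (Q i ∧ UntilAt s P Q (i + 1)) := by
  constructor
  · rintro (⟨k, hk, hP, hQ⟩ | ⟨hs, hQ⟩)
    · rcases hk.eq_or_lt with rfl | hlt
      · exact Or.inl hP
      · exact Or.inr ⟨hQ i le_rfl hlt, Or.inl ⟨k, hlt, hP, fun j hj => hQ j (by omega)⟩⟩
    · exact Or.inr ⟨hQ i le_rfl, Or.inr ⟨hs, fun j hj => hQ j (by omega)⟩⟩
  · rintro (hP | ⟨hQi, ⟨k, hk, hP, hQ⟩ | ⟨hs, hQ⟩⟩)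
    · exact Or.inl ⟨i, le_rfl, hP, fun j _ _ => by omega⟩
    · refine Or.inl ⟨k, by omega, hP, fun j hj hjk => ?_⟩
      rcases hj.eq_or_lt with rfl | hlt
      · exact hQi
      · exact hQ j hlt hjk
    · refine Or.inr ⟨hs, fun j hj => ?_⟩
      rcases hj.eq_or_lt with rfl | hlt
      · exact hQi
      · exact hQ j hlt

theorem forall_of_not_untilAt {s : Bool} {P Q E : ℕ → Prop} {i : ℕ} (hi : E i)
    (hE : ∀ t, E t → P t ∨ (Q t ∧ E (t + 1))) (hn : ¬ UntilAt s P Q i) :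
    ∀ t, i ≤ t → ¬ P t ∧ Q t ∧ E t := by
  have key : ∀ t, i ≤ t → E t ∧ ¬ UntilAt s P Q t := by
    intro t ht
    induction t, ht using Nat.le_induction with
    | base => exact ⟨hi, hn⟩
    | succ t ht ih =>
      rw [untilAt_iff] at ih
      have := hE t ih.1
      tauto
  intro t ht
  have h := key t ht
  rw [untilAt_iff] at h
  have := hE t h.1
  tauto

theorem not_untilAt_iff {s : Bool} {P Q : ℕ → Prop} {i : ℕ} :
    ¬ UntilAt s P Q i ↔ UntilAt (!s) (fun j => ¬ Q j ∧ ¬ P j) (fun j => ¬ P j) i := by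
  constructor
  · intro hn
    by_contra hn'
    have h := forall_of_not_untilAt (E := fun t => ¬ UntilAt s P Q t) hn
      (fun t ht => by rw [untilAt_iff] at ht; tauto) hn'
    have hP : ∀ j, i ≤ j → ¬ P j := fun j hj => (h j hj).2.1
    have hQ : ∀ j, i ≤ j → Q j := fun j hj => by
      have := h j hj
      tauto
    cases s
    · exact hn (Or.inr ⟨rfl, hQ⟩)
    · exact hn' (Or.inr ⟨rfl, hP⟩)
  · rintro (⟨k, hk, ⟨hQ, hP⟩, hlt⟩ | ⟨hs, hP⟩) (⟨l, hl, hPl, hQl⟩ | ⟨hs', hQ'⟩)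
    · rcases lt_trichotomy k l with h | rfl | h
      · exact hQ (hQl k hk h)
      · exact hP hPl
      · exact hlt l hl h hPl
    · exact hQ (hQ' k hk)
    · exact hP l hl hPl
    · simp_all

namespace NNF

variable {A : Type}

/-- Semantics of formulas in negation normal form. -/
def Sat (w : ℕ → A) : NNF A → ℕ → Prop
  | lit p, i => p (w i)
  | and φ ψ, i => Sat w φ i ∧ Sat w ψ i
  | or φ ψ, i => Sat w φ i ∨ Sat w ψ i
  | next φ, i => Sat w φ (i + 1)
  | unt s ψ φ, i => UntilAt s (Sat w ψ) (Sat w φ) i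

/-- The dual formula. -/
def neg : NNF A → NNF A
  | lit p => lit fun a => ¬ p a
  | and φ ψ => or (neg φ) (neg ψ)
  | or φ ψ => and (neg φ) (neg ψ)
  | next φ => next (neg φ)
  | unt s ψ φ => unt (!s) (and (neg φ) (neg ψ)) (neg ψ)

theorem sat_neg (w : ℕ → A) (φ : NNF A) (i : ℕ) : φ.neg.Sat w i ↔ ¬ φ.Sat w i := by
  induction φ generalizing i with
  | lit p => rfl
  | and φ ψ h₁ h₂ => simp only [neg, Sat, h₁, h₂]; tauto
  | or φ ψ h₁ h₂ => simp only [neg, Sat, h₁, h₂]; tauto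
  | next φ h => exact h _
  | unt s ψ φ h₁ h₂ =>
    simp only [neg, Sat, not_untilAt_iff]
    have e₁ : Sat w ψ.neg = fun j => ¬ Sat w ψ j := funext fun j => propext (h₁ j)
    have e₂ : Sat w φ.neg = fun j => ¬ Sat w φ j := funext fun j => propext (h₂ j)
    rw [e₁, e₂]

open scoped Classical in
/-- The temporal subformulas of a formula. -/
noncomputable def closure : NNF A → Finset (NNF A)
  | lit _ => ∅
  | and φ ψ => closure φ ∪ closure ψ
  | or φ ψ => closure φ ∪ closure ψ
  | next φ => insert (next φ) (closure φ)
  | unt s ψ φ => insert (unt s ψ φ) (closure ψ ∪ closure φ)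

open scoped Classical in
theorem closure_neg (φ : NNF A) : φ.neg.closure = φ.closure.image neg := by
  induction φ with
  | lit p => rfl
  | and φ ψ h₁ h₂ => simp only [neg, closure, h₁, h₂, Finset.image_union]
  | or φ ψ h₁ h₂ => simp only [neg, closure, h₁, h₂, Finset.image_union]
  | next φ h => simp only [neg, closure, h, Finset.image_insert]
  | unt s ψ φ h₁ h₂ =>
    simp only [neg, closure, h₁, h₂, Finset.image_insert, Finset.image_union]
    ext
    simp only [Finset.mem_insert, Finset.mem_union]
    tauto

/-- Formulas without strong until. -/
inductive IsSafety : NNF A → Prop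
  | lit (p : A → Prop) : IsSafety (lit p)
  | and {φ ψ : NNF A} : IsSafety φ → IsSafety ψ → IsSafety (and φ ψ)
  | or {φ ψ : NNF A} : IsSafety φ → IsSafety ψ → IsSafety (or φ ψ)
  | next {φ : NNF A} : IsSafety φ → IsSafety (next φ)
  | unt {ψ φ : NNF A} : IsSafety ψ → IsSafety φ → IsSafety (unt false ψ φ)

/-- Formulas in which the right operand of every weak until has no strong until. -/
inductive IsPersistence : NNF A → Prop
  | lit (p : A → Prop) : IsPersistence (lit p)
  | and {φ ψ : NNF A} : IsPersistence φ → IsPersistence ψ → IsPersistence (and φ ψ)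
  | or {φ ψ : NNF A} : IsPersistence φ → IsPersistence ψ → IsPersistence (or φ ψ)
  | next {φ : NNF A} : IsPersistence φ → IsPersistence (next φ)
  | su {ψ φ : NNF A} : IsPersistence ψ → IsPersistence φ → IsPersistence (unt true ψ φ)
  | wu {ψ φ : NNF A} : IsPersistence ψ → IsSafety φ → IsPersistence (unt false ψ φ)

theorem IsSafety.isPersistence {φ : NNF A} (h : IsSafety φ) : IsPersistence φ := by
  induction h with
  | lit p => exact .lit p
  | and _ _ h₁ h₂ => exact .and h₁ h₂
  | or _ _ h₁ h₂ => exact .or h₁ h₂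
  | next _ h => exact .next h
  | unt _ hφ h₁ _ => exact .wu h₁ hφ

theorem IsSafety.isPersistence_neg {φ : NNF A} (h : IsSafety φ) : IsPersistence φ.neg := by
  induction h with
  | lit p => exact .lit _
  | and _ _ h₁ h₂ => exact .or h₁ h₂
  | or _ _ h₁ h₂ => exact .and h₁ h₂
  | next _ h => exact .next h
  | unt _ _ h₁ h₂ => exact .su (.and h₂ h₁) h₁

/-- The strong until formulas. -/
def IsStrong : NNF A → Prop
  | unt true _ _ => True
  | _ => False

/-- What a temporal formula, as a member of a state, requires at the current position. -/
def obligation : NNF A → NNF A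
  | next φ => φ
  | φ => φ

/-- Evaluation of a formula on the current letter, given the set `U` of temporal formulas whose
obligations are imposed on the next position. -/
def EvalStep (a : A) (U : Set (NNF A)) : NNF A → Prop
  | lit p => p a
  | and φ ψ => EvalStep a U φ ∧ EvalStep a U ψ
  | or φ ψ => EvalStep a U φ ∨ EvalStep a U ψ
  | next φ => next φ ∈ U
  | unt s ψ φ => EvalStep a U ψ ∨ (EvalStep a U φ ∧ unt s ψ φ ∈ U)

theorem EvalStep.mono {a : A} {U U' : Set (NNF A)} {φ : NNF A}
    (h : φ.EvalStep a U) (hU : ∀ ξ ∈ φ.closure, ξ ∈ U → ξ ∈ U') : φ.EvalStep a U' := by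
  induction φ with
  | lit p => exact h
  | and φ ψ h₁ h₂ =>
    simp only [closure, Finset.mem_union] at hU
    exact ⟨h₁ h.1 fun ξ hξ => hU ξ (.inl hξ), h₂ h.2 fun ξ hξ => hU ξ (.inr hξ)⟩
  | or φ ψ h₁ h₂ =>
    simp only [closure, Finset.mem_union] at hU
    exact h.imp (fun h => h₁ h fun ξ hξ => hU ξ (.inl hξ))
      (fun h => h₂ h fun ξ hξ => hU ξ (.inr hξ))
  | next φ _ => exact hU _ (by simp [closure]) h
  | unt s ψ φ h₁ h₂ =>
    simp only [closure, Finset.mem_union, Finset.mem_insert] at hU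
    exact h.imp (fun h => h₁ h fun ξ hξ => hU ξ (.inr (.inl hξ)))
      (And.imp (fun h => h₂ h fun ξ hξ => hU ξ (.inr (.inr hξ))) (hU _ (.inl rfl)))

/-- The set `U t` of temporal formulas imposes its obligations on position `t` of `w`, and these
are propagated correctly. -/
def IsConsistent (w : ℕ → A) (U : ℕ → Set (NNF A)) : Prop :=
  ∀ t, ∀ ξ ∈ U t, ξ.obligation.EvalStep (w t) (U (t + 1))

theorem sat_of_evalStep {w : ℕ → A} {U : ℕ → Set (NNF A)} (hU : IsConsistent w U)
    {T : ℕ} (hT : ∀ t, T ≤ t → ∀ ξ ∈ U t, ¬ ξ.IsStrong) {φ : NNF A} {i : ℕ}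
    (h : φ.EvalStep (w i) (U (i + 1))) : φ.Sat w i := by
  induction φ generalizing i with
  | lit p => exact h
  | and φ ψ h₁ h₂ => exact ⟨h₁ h.1, h₂ h.2⟩
  | or φ ψ h₁ h₂ => exact h.imp h₁ h₂
  | next φ ih => exact ih (hU _ _ h)
  | unt s ψ φ h₁ h₂ =>
    by_contra hn
    have key := forall_of_not_untilAt
      (E := fun t => (unt s ψ φ).EvalStep (w t) (U (t + 1))) h
      (fun t ht => ht.imp h₁ (And.imp h₂ (hU _ _))) hn
    cases s with
    | false => exact hn (Or.inr ⟨rfl, fun j hj => (key j hj).2.1⟩)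
    | true =>
      obtain ⟨hψ, -, hev⟩ := key (max i T) (le_max_left _ _)
      rcases hev with hev | ⟨-, hev⟩
      · exact hψ (h₁ hev)
      · exact hT _ (by omega) _ hev trivial

/-- The satisfied obligations of safety formulas. -/
def safetyRun (w : ℕ → A) (t : ℕ) : Set (NNF A) :=
  {ξ | ξ.obligation.IsSafety ∧ ξ.obligation.Sat w t ∧ ¬ ξ.IsStrong}

theorem IsSafety.evalStep_safetyRun {w : ℕ → A} {φ : NNF A} (hφ : IsSafety φ) {i : ℕ}
    (h : φ.Sat w i) : φ.EvalStep (w i) (safetyRun w (i + 1)) := by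
  induction hφ with
  | lit p => exact h
  | and _ _ h₁ h₂ => exact ⟨h₁ h.1, h₂ h.2⟩
  | or _ _ h₁ h₂ => exact h.imp h₁ h₂
  | next hφ _ => exact ⟨hφ, h, id⟩
  | unt hψ hφ h₁ h₂ =>
    exact (untilAt_iff.1 h).imp h₁ (And.imp h₂ fun h => ⟨.unt hψ hφ, h, id⟩)

/-- A consistent sequence of obligations that eventually has no strong until. -/
structure IsAcceptingRun (w : ℕ → A) (U : ℕ → Set (NNF A)) : Prop where
  consistent : IsConsistent w U
  eventually : ∃ T, ∀ t, T ≤ t → ∀ ξ ∈ U t, ¬ ξ.IsStrong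

theorem isAcceptingRun_safetyRun (w : ℕ → A) : IsAcceptingRun w (safetyRun w) :=
  ⟨fun _ _ hξ => hξ.1.evalStep_safetyRun hξ.2.1, 0, fun _ _ _ hξ => hξ.2.2⟩

theorem IsAcceptingRun.union {w : ℕ → A} {U U' : ℕ → Set (NNF A)}
    (h : IsAcceptingRun w U) (h' : IsAcceptingRun w U') :
    IsAcceptingRun w fun t => U t ∪ U' t := by
  refine ⟨fun t ξ hξ => ?_, ?_⟩
  · rcases hξ with hξ | hξ
    · exact (h.consistent t ξ hξ).mono fun _ _ => Or.inl
    · exact (h'.consistent t ξ hξ).mono fun _ _ => Or.inr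
  · obtain ⟨T, hT⟩ := h.eventually
    obtain ⟨T', hT'⟩ := h'.eventually
    exact ⟨max T T', fun t ht ξ hξ => hξ.elim (hT t (by omega) ξ) (hT' t (by omega) ξ)⟩

theorem IsAcceptingRun.insert {w : ℕ → A} {U : ℕ → Set (NNF A)} (h : IsAcceptingRun w U)
    {ξ : NNF A} {i : ℕ} (hξ : ξ.obligation.EvalStep (w i) (U (i + 1))) :
    IsAcceptingRun w fun t => {ζ | ζ ∈ U t ∨ (t = i ∧ ζ = ξ)} := by
  refine ⟨?_, ?_⟩
  · rintro t ζ (hζ | ⟨rfl, rfl⟩)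
    · exact (h.consistent t ζ hζ).mono fun _ _ => Or.inl
    · exact hξ.mono fun _ _ => Or.inl
  · obtain ⟨T, hT⟩ := h.eventually
    refine ⟨max T (i + 1), fun t ht ζ hζ => ?_⟩
    rcases hζ with hζ | ⟨rfl, -⟩
    · exact hT t (by omega) ζ hζ
    · omega

theorem exists_isAcceptingRun_unt {w : ℕ → A} {s : Bool} {ψ φ : NNF A}
    (hψ : ∀ i, ψ.Sat w i → ∃ U, IsAcceptingRun w U ∧ ψ.EvalStep (w i) (U (i + 1)))
    (hφ : ∀ i, φ.Sat w i → ∃ U, IsAcceptingRun w U ∧ φ.EvalStep (w i) (U (i + 1)))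
    {k : ℕ} (hk : ψ.Sat w k) {i : ℕ} (hik : i ≤ k)
    (h : ∀ j, i ≤ j → j < k → φ.Sat w j) :
    ∃ U, IsAcceptingRun w U ∧ (unt s ψ φ).EvalStep (w i) (U (i + 1)) := by
  induction hik using Nat.decreasingInduction with
  | self =>
    obtain ⟨U, hU, hev⟩ := hψ k hk
    exact ⟨U, hU, Or.inl hev⟩
  | of_succ i hik ih =>
    obtain ⟨U, hU, hev⟩ := ih fun j hj => h j (by omega)
    obtain ⟨U', hU', hev'⟩ := hφ i (h i le_rfl hik)
    refine ⟨_, hU'.union (hU.insert (ξ := unt s ψ φ) hev), Or.inr ⟨?_, ?_⟩⟩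
    · exact hev'.mono fun _ _ => Or.inl
    · exact Or.inr (Or.inr ⟨rfl, rfl⟩)

theorem IsPersistence.exists_isAcceptingRun {w : ℕ → A} {φ : NNF A} (hφ : IsPersistence φ)
    {i : ℕ} (h : φ.Sat w i) :
    ∃ U, IsAcceptingRun w U ∧ φ.EvalStep (w i) (U (i + 1)) := by
  induction hφ generalizing i with
  | lit p => exact ⟨_, isAcceptingRun_safetyRun w, h⟩
  | and _ _ h₁ h₂ =>
    obtain ⟨U, hU, hev⟩ := h₁ h.1
    obtain ⟨U', hU', hev'⟩ := h₂ h.2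
    exact ⟨_, hU.union hU', hev.mono fun _ _ => Or.inl, hev'.mono fun _ _ => Or.inr⟩
  | or _ _ h₁ h₂ =>
    rcases h with h | h
    · obtain ⟨U, hU, hev⟩ := h₁ h
      exact ⟨U, hU, Or.inl hev⟩
    · obtain ⟨U, hU, hev⟩ := h₂ h
      exact ⟨U, hU, Or.inr hev⟩
  | @next φ _ ih =>
    obtain ⟨U, hU, hev⟩ := ih (i := i + 1) h
    exact ⟨_, hU.insert (ξ := .next φ) hev, Or.inr ⟨rfl, rfl⟩⟩
  | su _ _ h₁ h₂ =>
    rcases h with ⟨k, hk, hψ, hlt⟩ | ⟨hs, -⟩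
    · exact exists_isAcceptingRun_unt (fun _ => h₁) (fun _ => h₂) hψ hk hlt
    · cases hs
  | @wu ψ φ _ hφ h₁ =>
    rcases h with ⟨k, hk, hψ, hlt⟩ | ⟨-, hall⟩
    · exact exists_isAcceptingRun_unt (fun _ => h₁)
        (fun _ h => ⟨_, isAcceptingRun_safetyRun w, hφ.evalStep_safetyRun h⟩) hψ hk hlt
    · have hev : ∀ t, i ≤ t → φ.EvalStep (w t) (safetyRun w (t + 1)) :=
        fun t ht => hφ.evalStep_safetyRun (hall t ht)
      refine ⟨fun t => {ζ | ζ ∈ safetyRun w t ∨ (i ≤ t ∧ ζ = unt false ψ φ)},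
        ⟨?_, 0, ?_⟩, Or.inr ⟨?_, Or.inr ⟨by omega, rfl⟩⟩⟩
      · rintro t ζ (hζ | ⟨ht, rfl⟩)
        · exact ((isAcceptingRun_safetyRun w).consistent t ζ hζ).mono fun _ _ => Or.inl
        · exact Or.inr ⟨(hev t ht).mono fun _ _ => Or.inl, Or.inr ⟨by omega, rfl⟩⟩
      · rintro t - ζ (hζ | ⟨-, rfl⟩)
        · exact hζ.2.2
        · exact id
      · exact (hev i le_rfl).mono fun _ _ => Or.inl

theorem closure_subset_of_mem {φ ξ : NNF A} (h : ξ ∈ φ.closure) :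
    ξ.obligation.closure ⊆ φ.closure := by
  classical
  induction φ with
  | lit p => simp [closure] at h
  | and φ ψ h₁ h₂ =>
    simp only [closure, Finset.mem_union] at h ⊢
    rcases h with h | h
    · exact (h₁ h).trans Finset.subset_union_left
    · exact (h₂ h).trans Finset.subset_union_right
  | or φ ψ h₁ h₂ =>
    simp only [closure, Finset.mem_union] at h ⊢
    rcases h with h | h
    · exact (h₁ h).trans Finset.subset_union_left
    · exact (h₂ h).trans Finset.subset_union_right
  | next φ ih =>
    simp only [closure, Finset.mem_insert] at h ⊢
    rcases h with rfl | h
    · exact Finset.subset_insert _ _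
    · exact (ih h).trans (Finset.subset_insert _ _)
  | unt s ψ φ h₁ h₂ =>
    simp only [closure, Finset.mem_insert, Finset.mem_union] at h ⊢
    rcases h with rfl | h | h
    · exact subset_rfl
    · exact (h₁ h).trans (Finset.subset_union_left.trans (Finset.subset_insert _ _))
    · exact (h₂ h).trans (Finset.subset_union_right.trans (Finset.subset_insert _ _))

theorem sat_iff_exists_run (χ : NNF A) (hχ : χ.IsPersistence) (w : ℕ → A) :
    χ.Sat w 0 ↔ ∃ ρ : ℕ → Set χ.closure, χ.EvalStep (w 0) (Subtype.val '' ρ 0) ∧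
      (∀ t, ∀ ξ ∈ ρ t, ξ.val.obligation.EvalStep (w (t + 1)) (Subtype.val '' ρ (t + 1))) ∧
      ∃ T, ∀ t, T ≤ t → ∀ ξ ∈ ρ t, ¬ ξ.val.IsStrong := by
  constructor
  · intro h
    obtain ⟨U, hU, hev⟩ := hχ.exists_isAcceptingRun h
    obtain ⟨T, hT⟩ := hU.eventually
    refine ⟨fun t => {ξ | ξ.val ∈ U (t + 1)}, hev.mono fun ξ hξ hmem => ⟨⟨ξ, hξ⟩, hmem, rfl⟩,
      fun t ξ hξ => ?_, T, fun t ht ξ hξ => hT (t + 1) (by omega) _ hξ⟩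
    exact (hU.consistent _ _ hξ).mono
      fun ζ hζ hmem => ⟨⟨ζ, closure_subset_of_mem ξ.2 hζ⟩, hmem, rfl⟩
  · rintro ⟨ρ, h0, hstep, T, hT⟩
    let U : ℕ → Set (NNF A) := fun t => Nat.casesOn t ∅ fun t => Subtype.val '' ρ t
    have hU : IsConsistent w U := by
      rintro (_ | t) ξ hξ
      · exact hξ.elim
      · obtain ⟨ξ, hξ, rfl⟩ := hξ
        exact hstep t ξ hξ
    refine sat_of_evalStep hU (T := T + 1) ?_ h0
    rintro (_ | t) ht ξ hξ
    · exact hξ.elim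
    · obtain ⟨ξ, hξ, rfl⟩ := hξ
      exact hT t (by omega) ξ hξ

/-- The property `P` of positions in words is expressed by a formula in the class `C` with fewer
than `n` temporal subformulas. -/
def Represents (C : NNF A → Prop) (n : ℕ) (P : (ℕ → A) → ℕ → Prop) : Prop :=
  ∃ χ : NNF A, C χ ∧ χ.closure.card + 1 ≤ n ∧ ∀ w i, χ.Sat w i ↔ P w i

namespace Represents

variable {C C' : NNF A → Prop} {m n k : ℕ} {P Q R : (ℕ → A) → ℕ → Prop}

theorem mono (h : Represents C m P) (hC : ∀ χ, C χ → C' χ) (hm : m ≤ n)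
    (hP : ∀ w i, P w i ↔ Q w i) : Represents C' n Q := by
  obtain ⟨χ, h₁, h₂, h₃⟩ := h
  exact ⟨χ, hC χ h₁, h₂.trans hm, fun w i => (h₃ w i).trans (hP w i)⟩

theorem neg (h : Represents C m P) (hC : ∀ χ, C χ → C' χ.neg) :
    Represents C' m fun w i => ¬ P w i := by
  classical
  obtain ⟨χ, h₁, h₂, h₃⟩ := h
  refine ⟨χ.neg, hC χ h₁, ?_, fun w i => by rw [sat_neg, h₃]⟩
  have := Finset.card_image_le (s := χ.closure) (f := NNF.neg)
  rw [closure_neg]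
  omega

theorem lit (p : A → Prop) (hC : C (.lit p)) (hn : 1 ≤ n) :
    Represents C n fun w i => p (w i) :=
  ⟨.lit p, hC, by simpa [closure] using hn, fun _ _ => Iff.rfl⟩

theorem and (h : Represents C m P) (h' : Represents C n Q)
    (hC : ∀ {φ ψ}, C φ → C ψ → C (.and φ ψ)) (hk : m + n ≤ k)
    (hR : ∀ w i, P w i ∧ Q w i ↔ R w i) : Represents C k R := by
  classical
  obtain ⟨χ, h₁, h₂, h₃⟩ := h
  obtain ⟨χ', h₁', h₂', h₃'⟩ := h'
  refine ⟨.and χ χ', hC h₁ h₁', ?_, fun w i => by rw [← hR, ← h₃, ← h₃']; rfl⟩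
  have := Finset.card_union_le χ.closure χ'.closure
  simp only [closure]
  omega

theorem or (h : Represents C m P) (h' : Represents C n Q)
    (hC : ∀ {φ ψ}, C φ → C ψ → C (.or φ ψ)) (hk : m + n ≤ k)
    (hR : ∀ w i, P w i ∨ Q w i ↔ R w i) : Represents C k R := by
  classical
  obtain ⟨χ, h₁, h₂, h₃⟩ := h
  obtain ⟨χ', h₁', h₂', h₃'⟩ := h'
  refine ⟨.or χ χ', hC h₁ h₁', ?_, fun w i => by rw [← hR, ← h₃, ← h₃']; rfl⟩
  have := Finset.card_union_le χ.closure χ'.closure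
  simp only [closure]
  omega

theorem next (h : Represents C m P) (hC : ∀ {φ}, C φ → C (.next φ)) (hk : m + 1 ≤ k)
    (hR : ∀ w i, P w (i + 1) ↔ R w i) : Represents C k R := by
  classical
  obtain ⟨χ, h₁, h₂, h₃⟩ := h
  refine ⟨.next χ, hC h₁, ?_, fun w i => by rw [← hR, ← h₃]; rfl⟩
  have := Finset.card_insert_le (NNF.next χ) χ.closure
  simp only [closure]
  omega

theorem unt {C'' : NNF A → Prop} {s : Bool} (h : Represents C m P) (h' : Represents C' n Q)
    (hC : ∀ {ψ φ}, C ψ → C' φ → C'' (.unt s ψ φ)) (hk : m + n ≤ k)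
    (hR : ∀ w i, UntilAt s (P w) (Q w) i ↔ R w i) : Represents C'' k R := by
  classical
  obtain ⟨χ, h₁, h₂, h₃⟩ := h
  obtain ⟨χ', h₁', h₂', h₃'⟩ := h'
  refine ⟨.unt s χ χ', hC h₁ h₁', ?_, fun w i => ?_⟩
  · have := Finset.card_insert_le (NNF.unt s χ χ') (χ.closure ∪ χ'.closure)
    have := Finset.card_union_le χ.closure χ'.closure
    simp only [closure]
    omega
  · have e : P w = χ.Sat w := funext fun j => propext (h₃ w j).symm
    have e' : Q w = χ'.Sat w := funext fun j => propext (h₃' w j).symm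
    rw [← hR, e, e']
    rfl

/-- Representation of a negated until: `¬ (ψ U φ)` is `(¬ φ ∧ ¬ ψ) U (¬ ψ)` with the other
strength, whose closure does not count the repeated operand twice. -/
theorem release {C'' : NNF A → Prop} {s : Bool} (h : Represents C m P)
    (h' : Represents C' n Q)
    (hC : ∀ {ψ φ}, C ψ → C' φ → C'' (.unt s (.and φ ψ) ψ)) (hk : m + n ≤ k)
    (hR : ∀ w i, UntilAt s (fun j => Q w j ∧ P w j) (P w) i ↔ R w i) : Represents C'' k R := by
  classical
  obtain ⟨χ, h₁, h₂, h₃⟩ := h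
  obtain ⟨χ', h₁', h₂', h₃'⟩ := h'
  refine ⟨.unt s (.and χ' χ) χ, hC h₁ h₁', ?_, fun w i => ?_⟩
  · have := Finset.card_insert_le (NNF.unt s (.and χ' χ) χ) (χ'.closure ∪ χ.closure)
    have := Finset.card_union_le χ'.closure χ.closure
    simp only [closure, Finset.union_assoc, Finset.union_self]
    omega
  · have e : P w = χ.Sat w := funext fun j => propext (h₃ w j).symm
    have e' : Q w = χ'.Sat w := funext fun j => propext (h₃' w j).symm
    rw [← hR, e, e']
    rfl

end Represents

end NNF

namespace LTL

open NNF

variable {V : Type}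

theorem sat_land {w : ℕ → Set V} {φ ψ : LTL V} {i : ℕ} :
    Sat w (land φ ψ) i ↔ Sat w φ i ∧ Sat w ψ i := by
  simp only [land, Sat]
  tauto

theorem sat_lsu {w : ℕ → Set V} {ψ φ : LTL V} {i : ℕ} :
    Sat w (lsu ψ φ) i ↔ UntilAt true (Sat w ψ) (Sat w φ) i := by
  simp [Sat, UntilAt]

theorem sat_lF {w : ℕ → Set V} {φ : LTL V} {i : ℕ} :
    Sat w (lF φ) i ↔ UntilAt true (Sat w φ) (fun _ => True) i :=
  sat_lsu

theorem sat_lG {w : ℕ → Set V} {φ : LTL V} {i : ℕ} :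
    Sat w (lG φ) i ↔ UntilAt false (fun _ => False) (Sat w φ) i := by
  simp [lG, lF, Sat, UntilAt]

theorem sat_lwu {w : ℕ → Set V} {ψ φ : LTL V} {i : ℕ} :
    Sat w (lwu ψ φ) i ↔ UntilAt false (Sat w ψ) (Sat w φ) i := by
  simp [lwu, lG, lF, Sat, UntilAt]

mutual

theorem TLG.repr {φ : LTL V} : TLG φ → Represents IsSafety φ.size fun w i => Sat w φ i
  | .var v => .lit (v ∈ ·) (.lit _) le_rfl
  | .not h => (TLF.repr_not h).mono (fun _ => id) (by simp [size]) fun _ _ => Iff.rfl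
  | .and h h' => (TLG.repr h).and (TLG.repr h') .and (by simp only [land, size]; omega)
      fun _ _ => sat_land.symm
  | .or h h' => (TLG.repr h).or (TLG.repr h') .or (by simp only [size]; omega)
      fun _ _ => Iff.rfl
  | .next h => (TLG.repr h).next .next (by simp [size]) fun _ _ => Iff.rfl
  | .alw h => (Represents.lit (fun _ => False) (.lit _) le_rfl).unt (TLG.repr h) .unt
      (by simp only [lG, lF, size]; omega) fun _ _ => sat_lG.symm
  | .wu h h' => (TLG.repr h).unt (TLG.repr h') .unt
      (by simp only [lwu, lG, lF, size]; omega) fun _ _ => sat_lwu.symm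

theorem TLF.repr_not {φ : LTL V} :
    TLF φ → Represents IsSafety φ.size fun w i => ¬ Sat w φ i
  | .var v => .lit (v ∉ ·) (.lit _) le_rfl
  | .not h => (TLG.repr h).mono (fun _ => id) (by simp [size]) fun _ _ => not_not.symm
  | .and h h' => (TLF.repr_not h).or (TLF.repr_not h') .or (by simp only [land, size]; omega)
      fun _ _ => by rw [sat_land, not_and_or]
  | .or h h' => (TLF.repr_not h).and (TLF.repr_not h') .and (by simp only [size]; omega)
      fun _ _ => not_or.symm
  | .next h => (TLF.repr_not h).next .next (by simp [size]) fun _ _ => Iff.rfl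
  | .ev h => (TLF.repr_not h).release (.lit (fun _ => ¬ True) (.lit _) le_rfl)
      (fun h h' => .unt (.and h' h) h) (by simp only [lF, size]; omega)
      fun _ _ => by rw [sat_lF, not_untilAt_iff]; rfl
  | .su h h' => (TLF.repr_not h).release (TLF.repr_not h')
      (fun h h' => .unt (.and h' h) h) (by simp only [size]; omega)
      fun _ _ => by rw [sat_lsu, not_untilAt_iff]; rfl

end

theorem TLF.repr {φ : LTL V} (h : TLF φ) :
    Represents IsPersistence φ.size fun w i => Sat w φ i :=
  ((TLF.repr_not h).neg fun _ => IsSafety.isPersistence_neg).mono (fun _ => id) le_rfl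
    fun _ _ => not_not

theorem TLPrefix.repr {φ : LTL V} (h : TLPrefix φ) :
    (Represents IsPersistence φ.size fun w i => Sat w φ i) ∧
      Represents IsPersistence φ.size fun w i => ¬ Sat w φ i := by
  induction h with
  | g h => exact ⟨(TLG.repr h).mono (fun _ => IsSafety.isPersistence) le_rfl fun _ _ => Iff.rfl,
      (TLG.repr h).neg fun _ => IsSafety.isPersistence_neg⟩
  | f h => exact ⟨TLF.repr h,
      (TLF.repr_not h).mono (fun _ => IsSafety.isPersistence) le_rfl fun _ _ => Iff.rfl⟩
  | not _ ih => exact ⟨ih.2.mono (fun _ => id) (by simp [size]) fun _ _ => Iff.rfl,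
      ih.1.mono (fun _ => id) (by simp [size]) fun _ _ => not_not.symm⟩
  | and _ _ ih ih' => exact ⟨ih.1.and ih'.1 .and (by simp only [land, size]; omega)
        fun _ _ => sat_land.symm,
      ih.2.or ih'.2 .or (by simp only [land, size]; omega)
        fun _ _ => by rw [sat_land, not_and_or]⟩
  | or _ _ ih ih' => exact ⟨ih.1.or ih'.1 .or (by simp only [size]; omega) fun _ _ => Iff.rfl,
      ih.2.and ih'.2 .and (by simp only [size]; omega) fun _ _ => not_or.symm⟩

mutual

theorem TLGF.repr_not {φ : LTL V} :
    TLGF φ → Represents IsPersistence φ.size fun w i => ¬ Sat w φ i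
  | .pre h => h.repr.2
  | .not h => (TLFG.repr h).mono (fun _ => id) (by simp [size]) fun _ _ => not_not.symm
  | .and h h' => (TLGF.repr_not h).or (TLGF.repr_not h') .or (by simp only [land, size]; omega)
      fun _ _ => by rw [sat_land, not_and_or]
  | .or h h' => (TLGF.repr_not h).and (TLGF.repr_not h') .and (by simp only [size]; omega)
      fun _ _ => not_or.symm
  | .next h => (TLGF.repr_not h).next .next (by simp [size]) fun _ _ => Iff.rfl
  | .alw h => (Represents.lit (fun _ => ¬ False) (.lit _) le_rfl).release (TLGF.repr_not h)
      (fun h h' => .su (.and h' h) h) (by simp only [lG, lF, size]; omega)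
      fun _ _ => by rw [sat_lG, not_untilAt_iff]; rfl
  | .wu h h' => (TLGF.repr_not h).release (TLGF.repr_not h')
      (fun h h' => .su (.and h' h) h) (by simp only [lwu, lG, lF, size]; omega)
      fun _ _ => by rw [sat_lwu, not_untilAt_iff]; rfl
  | .suF h h' => (TLF.repr_not h).release (TLGF.repr_not h')
      (fun h h' => .wu (.and h' h.isPersistence) h) (by simp only [size]; omega)
      fun _ _ => by rw [sat_lsu, not_untilAt_iff]; rfl

theorem TLFG.repr {φ : LTL V} :
    TLFG φ → Represents IsPersistence φ.size fun w i => Sat w φ i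
  | .pre h => h.repr.1
  | .not h => (TLGF.repr_not h).mono (fun _ => id) (by simp [size]) fun _ _ => Iff.rfl
  | .and h h' => (TLFG.repr h).and (TLFG.repr h') .and (by simp only [land, size]; omega)
      fun _ _ => sat_land.symm
  | .or h h' => (TLFG.repr h).or (TLFG.repr h') .or (by simp only [size]; omega)
      fun _ _ => Iff.rfl
  | .next h => (TLFG.repr h).next .next (by simp [size]) fun _ _ => Iff.rfl
  | .ev h => (TLFG.repr h).unt (.lit (fun _ => True) (.lit _) le_rfl) .su
      (by simp only [lF, size]; omega) fun _ _ => sat_lF.symm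
  | .su h h' => (TLFG.repr h).unt (TLFG.repr h') .su (by simp only [size]; omega)
      fun _ _ => sat_lsu.symm
  | .wuG h h' => (TLFG.repr h).unt (TLG.repr h') .wu
      (by simp only [lwu, lG, lF, size]; omega) fun _ _ => sat_lwu.symm

end

end LTL

section Breakpoint

variable {A Q : Type}

/-- `ρ` is a run of the nondeterministic automaton with transitions `step` that enters a state of
`start (w 0)` on the first letter, restricted to the first `k + 1` letters. -/
def IsRunUpTo (start : A → Set Q) (step : A → Q → Set Q) (w : ℕ → A) (k : ℕ) (ρ : ℕ → Q) : Prop :=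
  ρ 0 ∈ start (w 0) ∧ ∀ t, t < k → ρ (t + 1) ∈ step (w (t + 1)) (ρ t)

theorem IsRunUpTo.extend {start : A → Set Q} {step : A → Q → Set Q} {w : ℕ → A} {k : ℕ}
    {ρ : ℕ → Q} (h : IsRunUpTo start step w k ρ) {q : Q} (hq : q ∈ step (w (k + 1)) (ρ k)) :
    IsRunUpTo start step w (k + 1) (fun t => if t ≤ k then ρ t else q) := by
  refine ⟨by simpa using h.1, fun t ht => ?_⟩
  rcases (Nat.lt_succ_iff.1 ht).eq_or_lt with rfl | ht
  · simpa using hq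
  · simpa [ht.le, Nat.succ_le_of_lt ht] using h.2 t ht

/-- König's lemma for runs that stay in `good` from time `T` on. -/
theorem exists_run_of_forall_isRunUpTo [Finite Q] {start : A → Set Q} {step : A → Q → Set Q}
    {good : Set Q} {w : ℕ → A} {T : ℕ}
    (h : ∀ k, ∃ ρ, IsRunUpTo start step w k ρ ∧ ∀ t, T ≤ t → t ≤ k → ρ t ∈ good) :
    ∃ ρ : ℕ → Q, ρ 0 ∈ start (w 0) ∧ (∀ t, ρ (t + 1) ∈ step (w (t + 1)) (ρ t)) ∧
      ∀ t, T ≤ t → ρ t ∈ good := by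
  let _ : TopologicalSpace Q := ⊥
  have : DiscreteTopology Q := ⟨rfl⟩
  let K : ℕ → Set (ℕ → Q) := fun k =>
    {ρ | IsRunUpTo start step w k ρ ∧ ∀ t, T ≤ t → t ≤ k → ρ t ∈ good}
  have hclosed : ∀ k, IsClosed (K k) := by
    intro k
    have h₁ : ∀ (t : ℕ) (s : Set Q), IsClosed {ρ : ℕ → Q | ρ t ∈ s} := fun t s =>
      (isClosed_discrete s).preimage (continuous_apply t)
    have h₂ : ∀ t : ℕ, IsClosed {ρ : ℕ → Q | ρ (t + 1) ∈ step (w (t + 1)) (ρ t)} := fun t =>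
      (isClosed_discrete {p : Q × Q | p.2 ∈ step (w (t + 1)) p.1}).preimage
        (f := fun ρ : ℕ → Q => (ρ t, ρ (t + 1))) (by fun_prop)
    have e : K k = ({ρ | ρ 0 ∈ start (w 0)} ∩
        ⋂ t, ⋂ _ : t < k, {ρ | ρ (t + 1) ∈ step (w (t + 1)) (ρ t)}) ∩
        ⋂ t, ⋂ _ : T ≤ t, ⋂ _ : t ≤ k, {ρ | ρ t ∈ good} := by
      ext ρ
      simp [K, IsRunUpTo]
    rw [e]
    exact ((h₁ _ _).inter (isClosed_iInter fun t => isClosed_iInter fun _ => h₂ t)).inter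
      (isClosed_iInter fun t => isClosed_iInter fun _ => isClosed_iInter fun _ => h₁ t _)
  obtain ⟨ρ, hρ⟩ := IsCompact.nonempty_iInter_of_sequence_nonempty_isCompact_isClosed K
    (fun k ρ hρ => ⟨⟨hρ.1.1, fun t ht => hρ.1.2 t (by omega)⟩,
      fun t hT ht => hρ.2 t hT (by omega)⟩)
    h (hclosed 0).isCompact hclosed
  rw [Set.mem_iInter] at hρ
  exact ⟨ρ, (hρ 0).1.1, fun t => (hρ (t + 1)).1.2 t (by omega),
    fun t ht => (hρ t).2 t ht le_rfl⟩

open scoped Classical in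
/-- The breakpoint construction. A state `(S, O)` consists of the set `S` of reachable states and
the subset `O` of those reachable by staying in `good` since the last time `O` was empty; the state
`(∅, univ)` serves as the initial state. -/
noncomputable def breakpointStep (start : A → Set Q) (step : A → Q → Set Q) (good : Set Q)
    (p : Set Q × Set Q) (a : A) : Set Q × Set Q :=
  if p = (∅, Set.univ) then (start a, ∅)
  else (⋃ q ∈ p.1, step a q, (⋃ q ∈ if p.2 = ∅ then p.1 else p.2, step a q) ∩ good)

/-- The complement of a nondeterministic co-Büchi automaton is recognized by a deterministic
Büchi automaton. -/
theorem exists_deterministic_buechi_of_coBuechi [Finite Q] [Nonempty Q] (start : A → Set Q)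
    (step : A → Q → Set Q) (good : Set Q) :
    ∃ (S : Type) (_ : Fintype S) (s0 : S) (δ : S → A → S) (F : Set S),
      Fintype.card S ≤ 2 ^ (2 * Nat.card Q) ∧
      ∀ w : ℕ → A, (∀ N, ∃ t, N ≤ t ∧ detRun δ s0 w t ∈ F) ↔
        ¬ ∃ ρ : ℕ → Q, ρ 0 ∈ start (w 0) ∧ (∀ t, ρ (t + 1) ∈ step (w (t + 1)) (ρ t)) ∧
          ∃ T, ∀ t, T ≤ t → ρ t ∈ good := by
  classical
  have := Fintype.ofFinite Q
  refine ⟨Set Q × Set Q, inferInstance, (∅, Set.univ), breakpointStep start step good,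
    {p | p.2 = ∅}, ?_, fun w => ?_⟩
  · rw [Fintype.card_prod, Fintype.card_set, Nat.card_eq_fintype_card, two_mul, pow_add]
  let p : ℕ → Set Q × Set Q := fun t =>
    detRun (breakpointStep start step good) (∅, Set.univ) w (t + 1)
  have hp0 : p 0 = (start (w 0), ∅) := if_pos rfl
  have hsucc : ∀ t, (p t).2 ⊆ (p t).1 → p (t + 1) = (⋃ q ∈ (p t).1, step (w (t + 1)) q,
      (⋃ q ∈ if (p t).2 = ∅ then (p t).1 else (p t).2, step (w (t + 1)) q) ∩ good) := by
    intro t ht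
    refine if_neg fun heq => ?_
    change p t = _ at heq
    rw [heq] at ht
    exact ht (Set.mem_univ (Classical.arbitrary Q))
  have hsub : ∀ t, (p t).2 ⊆ (p t).1 := by
    intro t
    induction t with
    | zero => simp [hp0]
    | succ t ih =>
      rw [hsucc t ih]
      refine Set.inter_subset_left.trans (Set.biUnion_subset_biUnion_left ?_)
      split_ifs
      · exact subset_rfl
      · exact ih
  replace hsucc := fun t => hsucc t (hsub t)
  have hreach : ∀ t, ∀ q ∈ (p t).1, ∃ ρ, IsRunUpTo start step w t ρ ∧ ρ t = q := by
    intro t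
    induction t with
    | zero =>
      intro q hq
      rw [hp0] at hq
      exact ⟨fun _ => q, ⟨hq, fun t ht => by omega⟩, rfl⟩
    | succ t ih =>
      intro q hq
      simp only [hsucc, Set.mem_iUnion] at hq
      obtain ⟨q', hq', hq⟩ := hq
      obtain ⟨ρ, hρ, rfl⟩ := ih q' hq'
      exact ⟨_, hρ.extend hq, by simp⟩
  constructor
  · rintro hinf ⟨ρ, h0, hstep, T, hT⟩
    have hmem : ∀ t, ρ t ∈ (p t).1 := by
      intro t
      induction t with
      | zero => rwa [hp0]
      | succ t ih =>
        simp only [hsucc, Set.mem_iUnion]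
        exact ⟨_, ih, hstep t⟩
    have hmem' : ∀ t, T ≤ t → ρ t ∈ (if (p t).2 = ∅ then (p t).1 else (p t).2) →
        ρ (t + 1) ∈ (p (t + 1)).2 := by
      intro t ht h
      rw [hsucc]
      exact ⟨Set.mem_biUnion h (hstep t), hT _ (by omega)⟩
    obtain ⟨t, ht, hempty⟩ := hinf (T + 1)
    obtain ⟨t, rfl⟩ : ∃ k, t = k + 1 := ⟨t - 1, by omega⟩
    have hforever : ∀ k, t + 1 ≤ k → ρ k ∈ (p k).2 := by
      intro k hk
      induction k, hk using Nat.le_induction with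
      | base =>
        refine hmem' t (by omega) ?_
        rw [if_pos (show (p t).2 = ∅ from hempty)]
        exact hmem t
      | succ k hk ih =>
        refine hmem' k (by omega) ?_
        rwa [if_neg (Set.nonempty_iff_ne_empty.1 ⟨_, ih⟩)]
    obtain ⟨k, hk, hk'⟩ := hinf (t + 2)
    obtain ⟨k, rfl⟩ : ∃ j, k = j + 1 := ⟨k - 1, by omega⟩
    have hmemk := hforever k (by omega)
    change (p k).2 = ∅ at hk'
    rw [hk'] at hmemk
    exact hmemk
  · intro hno
    by_contra! hfin
    obtain ⟨T, hT⟩ := hfin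
    have hne : ∀ t, T ≤ t → (p t).2 ≠ ∅ := fun t ht => hT (t + 1) (by omega)
    have hgood : ∀ t, T ≤ t → ∀ q ∈ (p (t + 1)).2, ∃ ρ, IsRunUpTo start step w (t + 1) ρ ∧
        ρ (t + 1) = q ∧ ∀ s, T + 1 ≤ s → s ≤ t + 1 → ρ s ∈ good := by
      intro t ht
      induction t, ht using Nat.le_induction with
      | base =>
        intro q hq
        obtain ⟨ρ, hρ, hρq⟩ := hreach _ q (hsub _ hq)
        refine ⟨ρ, hρ, hρq, fun s hs hs' => ?_⟩
        obtain rfl : s = T + 1 := by omega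
        rw [hρq]
        rw [hsucc] at hq
        exact hq.2
      | succ t ht ih =>
        intro q hq
        rw [hsucc, if_neg (hne _ (by omega))] at hq
        obtain ⟨hq, hqg⟩ := hq
        simp only [Set.mem_iUnion] at hq
        obtain ⟨q', hq', hq⟩ := hq
        obtain ⟨ρ, hρ, rfl, hρg⟩ := ih q' hq'
        refine ⟨_, hρ.extend hq, by simp, fun s hs hs' => ?_⟩
        by_cases hst : s ≤ t + 1
        · simpa [hst] using hρg s hs hst
        · simpa [hst] using hqg
    refine hno ?_
    obtain ⟨ρ, h0, hstep, hρ⟩ := exists_run_of_forall_isRunUpTo (good := good) (T := T + 1)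
      (start := start) (step := step) (w := w) fun k => by
        obtain ⟨q, hq⟩ := Set.nonempty_iff_ne_empty.2 (hne (T + k + 1) (by omega))
        obtain ⟨ρ, hρ, -, hρg⟩ := hgood (T + k) (by omega) q hq
        exact ⟨ρ, ⟨hρ.1, fun t ht => hρ.2 t (by omega)⟩, fun t ht ht' => hρg t ht (by omega)⟩
    exact ⟨ρ, h0, hstep, T + 1, hρ⟩

end Breakpoint

/-- every `TL_GF` formula `Φ` is recognized by a deterministic
ω-automaton with a Büchi acceptance condition and at most `2 ^ 2 ^ |Φ|` states. -/
theorem tlGF_deterministic_buechi_automaton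
    {V : Type} [Fintype V] (Φ : LTL V) (hΦ : LTL.TLGF Φ) :
    ∃ (S : Type) (_ : Fintype S) (s0 : S) (δ : S → Set V → S) (F : Set S),
      Fintype.card S ≤ 2 ^ (2 ^ LTL.size Φ) ∧
      ∀ w : ℕ → Set V,
        ((∀ N, ∃ t, N ≤ t ∧ detRun δ s0 w t ∈ F) ↔ LTL.Sat w Φ 0) := by
  classical
  obtain ⟨χ, hχ, hcard, hsat⟩ := LTL.TLGF.repr_not hΦ
  obtain ⟨S, hS, s0, δ, F, hle, hacc⟩ := exists_deterministic_buechi_of_coBuechi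
    (Q := Set χ.closure) (fun a => {q | χ.EvalStep a (Subtype.val '' q)})
    (fun a q => {q' | ∀ ξ ∈ q, ξ.val.obligation.EvalStep a (Subtype.val '' q')})
    {q | ∀ ξ ∈ q, ¬ ξ.val.IsStrong}
  refine ⟨S, hS, s0, δ, F, hle.trans ?_, fun w => ?_⟩
  · rw [Nat.card_eq_fintype_card, Fintype.card_set, Fintype.card_coe, ← pow_succ']
    exact Nat.pow_le_pow_right two_pos (Nat.pow_le_pow_right two_pos hcard)
  · rw [hacc, ← not_iff_not, not_not]
    exact (χ.sat_iff_exists_run hχ w).symm.trans (hsat w 0)
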